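/- arXiv:2206.05632 — 2 statements merged into one kernel-verified Lean document; each statement's English description precedes it below -/
import Mathlib

section
/- Let s, t be real numbers in [0,1] with |1 − 2t| < |1 − 2s| and with 1 − 2t and 1 − 2s of the same sign. Then for every positive integer n and all positive real numbers λ₁, …, λₙ, the n×n matrix Y with entries y_{ij} = (λᵢ^{1−t}λⱼ^t − λᵢ^t λⱼ^{1−t})/(λᵢ^{1−s}λⱼ^s − λᵢ^s λⱼ^{1−s}) for λᵢ ≠ λⱼ and y_{ij} = (1−2t)/(1−2s) for λᵢ = λⱼ is positive semidefinite. (This is the key matrix positivity claim established in the proof of Theorem 2.5.) -/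
open Filter Topology MeasureTheory

namespace Matrix

variable {ι : Type*}

theorem PosSemidef.of_tendsto {α : Type*} {l : Filter α} [l.NeBot] {M : α → Matrix ι ι ℝ}
    {A : Matrix ι ι ℝ} (hM : ∀ a, (M a).PosSemidef)
    (h : ∀ i j, Tendsto (fun a => M a i j) l (𝓝 (A i j))) : A.PosSemidef := by
  refine ⟨IsHermitian.ext fun i j => ?_, fun x => ?_⟩
  · exact tendsto_nhds_unique (h j i) ((h i j).congr fun a => ((hM a).1.apply i j).symm)
  · refine ge_of_tendsto' (x := l) (f := fun a => x.sum fun i xi => x.sum fun j xj =>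
      star xi * M a i j * xj) ?_ fun a => (hM a).2 x
    exact tendsto_finsetSum _ fun i _ => tendsto_finsetSum _ fun j _ =>
      ((h i j).const_mul _).mul_const _

theorem PosSemidef.integral {α : Type*} [MeasurableSpace α] {μ : Measure α}
    {M : α → Matrix ι ι ℝ} (hM : ∀ a, (M a).PosSemidef)
    (h : ∀ i j, Integrable (fun a => M a i j) μ) :
    (of fun i j => ∫ a, M a i j ∂μ).PosSemidef := by
  refine ⟨IsHermitian.ext fun i j => ?_, fun x => ?_⟩
  · exact integral_congr_ae (.of_forall fun a => (hM a).1.apply i j)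
  · have key : ∫ a, (x.sum fun i xi => x.sum fun j xj => star xi * M a i j * xj) ∂μ =
        x.sum fun i xi => x.sum fun j xj => star xi * (∫ a, M a i j ∂μ) * xj := by
      simp only [Finsupp.sum]
      rw [integral_finsetSum _ fun i _ => integrable_finsetSum _ fun j _ =>
        ((h i j).const_mul _).mul_const _]
      refine Finset.sum_congr rfl fun i _ => ?_
      rw [integral_finsetSum _ fun j _ => ((h i j).const_mul _).mul_const _]
      exact Finset.sum_congr rfl fun j _ => by rw [integral_mul_const, integral_const_mul]
    simp only [of_apply, ← key]
    exact integral_nonneg fun a => (hM a).2 x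

theorem posSemidef_const [Finite ι] {c : ℝ} (hc : 0 ≤ c) : (of fun _ _ : ι => c).PosSemidef := by
  convert (posSemidef_vecMulVec_self_star (fun _ : ι => (1 : ℝ))).smul hc using 1
  ext
  simp [vecMulVec_apply]

theorem posSemidef_cos_sub [Finite ι] (x : ι → ℝ) : (of fun i j => Real.cos (x i - x j)).PosSemidef := by
  convert (posSemidef_vecMulVec_self_star fun i => Real.cos (x i)).add
    (posSemidef_vecMulVec_self_star fun i => Real.sin (x i)) using 1
  ext i j
  simp [vecMulVec_apply, Real.cos_sub]

end Matrix

theorem exp_mul_ofReal_re (u s : ℝ) :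
    (Complex.exp ((-1 + u * Complex.I) * s)).re = Real.exp (-s) * Real.cos (s * u) := by
  simp [Complex.exp_re, mul_comm]

theorem integrableOn_exp_neg_mul_cos (u : ℝ) :
    IntegrableOn (fun s : ℝ => Real.exp (-s) * Real.cos (s * u)) (Set.Ioi 0) := by
  simp only [← exp_mul_ofReal_re]
  exact (integrableOn_exp_mul_complex_Ioi (a := -1 + u * Complex.I) (by simp) 0).re

theorem integral_exp_neg_mul_cos (u : ℝ) :
    ∫ s in Set.Ioi (0 : ℝ), Real.exp (-s) * Real.cos (s * u) = 1 / (1 + u ^ 2) := by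
  have ha : (-1 + u * Complex.I).re < 0 := by simp
  simp only [← exp_mul_ofReal_re]
  rw [← RCLike.re_eq_complex_re,
    integral_re (integrableOn_exp_mul_complex_Ioi ha 0), integral_exp_mul_complex_Ioi ha]
  simp [Complex.div_re, Complex.normSq_apply, sq]

namespace Matrix

variable {ι : Type*}

theorem posSemidef_one_div_one_add_sq_sub [Finite ι] (x : ι → ℝ) :
    (of fun i j => 1 / (1 + (x i - x j) ^ 2)).PosSemidef := by
  have h := PosSemidef.integral (μ := volume.restrict (Set.Ioi 0))
    (M := fun s : ℝ => Real.exp (-s) • of fun i j => Real.cos (s * x i - s * x j))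
    (fun s => (posSemidef_cos_sub fun i => s * x i).smul (Real.exp_pos _).le)
    (fun i j => by simpa [← mul_sub] using! integrableOn_exp_neg_mul_cos (x i - x j))
  simpa [← mul_sub, integral_exp_neg_mul_cos] using h

theorem posSemidef_one_add_sq_div [Finite ι] {p q : ℝ} (hpq : |p| < |q|) (x : ι → ℝ) :
    (of fun i j => (1 + (p * (x i - x j)) ^ 2) / (1 + (q * (x i - x j)) ^ 2)).PosSemidef := by
  have hq : q ≠ 0 := abs_pos.mp ((abs_nonneg p).trans_lt hpq)
  have hr : p ^ 2 / q ^ 2 ≤ 1 := div_le_one_of_le₀ (sq_le_sq.mpr hpq.le) (sq_nonneg q)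
  convert (posSemidef_const (ι := ι) (c := p ^ 2 / q ^ 2) (by positivity)).add
    ((posSemidef_one_div_one_add_sq_sub fun i => q * x i).smul (sub_nonneg.mpr hr)) using 1
  ext i j
  have : 1 + q ^ 2 * (x i - x j) ^ 2 ≠ 0 := by positivity
  simp only [of_apply, add_apply, smul_apply, smul_eq_mul, ← mul_sub, mul_pow]
  field_simp
  ring

theorem PosSemidef.finset_prod [Finite ι] {κ : Type*} (s : Finset κ) {f : κ → ι → ι → ℝ}
    (hf : ∀ k ∈ s, (of (f k)).PosSemidef) : (of fun i j => ∏ k ∈ s, f k i j).PosSemidef := by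
  classical
  induction s using Finset.induction_on with
  | empty => simpa using posSemidef_const (ι := ι) zero_le_one
  | insert a s ha ih =>
    simp only [Finset.prod_insert ha]
    exact (hf a (by simp)).hadamard (ih fun k hk => hf k (by simp [hk]))

end Matrix

theorem Real.tendsto_euler_sinh_prod (x : ℝ) :
    Tendsto (fun n : ℕ => x * ∏ k ∈ Finset.range n, (1 + (x / (Real.pi * (k + 1))) ^ 2)) atTop
      (𝓝 (sinh x)) := by
  have h := ((Complex.tendsto_euler_sin_prod (x / Real.pi * Complex.I)).mul_const (-Complex.I))
  have hx : (Real.pi : ℂ) * (x / Real.pi * Complex.I) = x * Complex.I := by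
    have : (Real.pi : ℂ) ≠ 0 := by exact_mod_cast Real.pi_ne_zero
    field_simp
  rw [hx, Complex.sin_mul_I] at h
  have h' := (Complex.continuous_re.tendsto _).comp h
  convert h' using 1
  · ext n
    have : (x * Complex.I * (∏ k ∈ Finset.range n,
        (1 - (x / Real.pi * Complex.I) ^ 2 / ((k : ℂ) + 1) ^ 2)) * -Complex.I) =
        ((x * ∏ k ∈ Finset.range n, (1 + (x / (Real.pi * (k + 1))) ^ 2) : ℝ) : ℂ) := by
      push_cast
      rw [mul_right_comm, mul_assoc (x : ℂ), mul_neg, Complex.I_mul_I, neg_neg, mul_one]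
      congr 1
      refine Finset.prod_congr rfl fun k _ => ?_
      rw [mul_pow, Complex.I_sq, div_pow, div_pow, mul_pow, mul_neg_one, neg_div, sub_neg_eq_add,
        div_div]
    simp only [Function.comp_apply, this, Complex.ofReal_re]
  · rw [mul_assoc, mul_neg, Complex.I_mul_I, neg_neg, mul_one, Complex.sinh_ofReal_re]

theorem posSemidef_sinh_div_sinh {ι : Type*} [Finite ι] {a b : ℝ} (hab : |a| < |b|) (hpos : 0 ≤ a / b)
    (x : ι → ℝ) :
    (Matrix.of fun i j => if x i = x j then a / b
      else Real.sinh (a * (x i - x j)) / Real.sinh (b * (x i - x j))).PosSemidef := by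
  have hb : b ≠ 0 := abs_pos.mp ((abs_nonneg a).trans_lt hab)
  refine Matrix.PosSemidef.of_tendsto (l := atTop) (M := fun n : ℕ => (a / b) •
    Matrix.of fun i j => ∏ k ∈ Finset.range n,
      (1 + (a / (Real.pi * (k + 1)) * (x i - x j)) ^ 2) /
        (1 + (b / (Real.pi * (k + 1)) * (x i - x j)) ^ 2)) (fun n => ?_) fun i j => ?_
  · refine (Matrix.PosSemidef.finset_prod _ fun k _ =>
      Matrix.posSemidef_one_add_sq_div ?_ x).smul hpos
    have : 0 < |Real.pi * ((k : ℝ) + 1)| := abs_pos.mpr (by positivity)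
    rw [abs_div, abs_div]
    gcongr
  · by_cases hij : x i = x j
    · simp [hij]
    · have hd : x i - x j ≠ 0 := sub_ne_zero.mpr hij
      have hsinh : Real.sinh (b * (x i - x j)) ≠ 0 := by simp [Real.sinh_eq_zero, hb, hd]
      have h := (Real.tendsto_euler_sinh_prod (a * (x i - x j))).div
        (Real.tendsto_euler_sinh_prod (b * (x i - x j))) hsinh
      simp only [Matrix.of_apply, if_neg hij]
      refine h.congr fun n => ?_
      simp only [Pi.div_apply, Matrix.smul_apply, Matrix.of_apply, smul_eq_mul,
        Finset.prod_div_distrib, div_mul_eq_mul_div]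
      rw [mul_div_mul_comm, mul_div_mul_right _ _ hd]
      ring

theorem rpow_mul_rpow_sub_eq_sinh {x y : ℝ} (hx : 0 < x) (hy : 0 < y) (r : ℝ) :
    x ^ (1 - r) * y ^ r - x ^ r * y ^ (1 - r) =
      2 * Real.exp ((Real.log x + Real.log y) / 2) *
        Real.sinh ((1 - 2 * r) / 2 * (Real.log x - Real.log y)) := by
  simp only [Real.rpow_def_of_pos hx, Real.rpow_def_of_pos hy, Real.sinh_eq, ← Real.exp_add]
  rw [mul_right_comm, mul_div_cancel₀ _ two_ne_zero, sub_mul, ← Real.exp_add, ← Real.exp_add]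
  ring_nf


/-- Key matrix positivity claim from the proof of Theorem 2.5: if `s, t ∈ [0,1]` with
`|1 - 2t| < |1 - 2s|` and `1 - 2t`, `1 - 2s` of the same sign, the matrix with entries
`(λᵢ^{1-t}λⱼ^t - λᵢ^t λⱼ^{1-t}) / (λᵢ^{1-s}λⱼ^s - λᵢ^s λⱼ^{1-s})` (interpreted as
`(1-2t)/(1-2s)` when `λᵢ = λⱼ`) is positive semidefinite. -/
theorem sinh_quotient_matrix_posSemidef (s t : ℝ) (hs0 : 0 ≤ s) (hs1 : s ≤ 1)
    (ht0 : 0 ≤ t) (ht1 : t ≤ 1) (hts : |1 - 2 * t| < |1 - 2 * s|)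
    (hsign : 0 < (1 - 2 * t) * (1 - 2 * s))
    (n : ℕ) (lam : Fin n → ℝ) (hlam : ∀ i, 0 < lam i) :
    (Matrix.of fun i j : Fin n =>
      if lam i = lam j then (1 - 2 * t) / (1 - 2 * s)
      else (lam i ^ (1 - t) * lam j ^ t - lam i ^ t * lam j ^ (1 - t)) /
        (lam i ^ (1 - s) * lam j ^ s - lam i ^ s * lam j ^ (1 - s))).PosSemidef := by
  have hs : 1 - 2 * s ≠ 0 := right_ne_zero_of_mul hsign.ne'
  convert posSemidef_sinh_div_sinh (a := (1 - 2 * t) / 2) (b := (1 - 2 * s) / 2)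
    (by rw [abs_div, abs_div]; gcongr) ?_ fun i => Real.log (lam i) using 1
  · ext i j
    simp only [Matrix.of_apply, Real.log_injOn_pos.eq_iff (hlam i) (hlam j),
      rpow_mul_rpow_sub_eq_sinh (hlam i) (hlam j), div_div_div_cancel_right₀ (two_ne_zero' ℝ)]
    rw [mul_div_mul_left _ _ (by positivity)]
  · rw [div_div_div_cancel_right₀ two_ne_zero]
    exact (div_pos_iff.mpr (mul_pos_iff.mp hsign)).le
end

section
/- Let A and B be n×n positive semidefinite complex matrices, X an arbitrary n×n complex matrix, and let s, t be real numbers in [0,1] with |1 − 2t| < |1 − 2s| and with 1 − 2t and 1 − 2s of the same sign. Then ‖A^{1−t}XB^t − A^tXB^{1−t}‖_F ≤ |(1−2t)/(1−2s)| · ‖A^{1−s}XB^s − A^sXB^{1−s}‖_F, where ‖·‖_F denotes the Frobenius norm. (Theorem 2.5, instance for the Frobenius norm) -/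
open scoped ComplexOrder

/-- Matrix power of a positive semidefinite matrix via the continuous functional calculus
(equivalently, raising each eigenvalue to the power `v` in a spectral decomposition). -/
noncomputable def mpow {n : ℕ} (A : Matrix (Fin n) (Fin n) ℂ) (v : ℝ) :
    Matrix (Fin n) (Fin n) ℂ :=
  cfc (fun x : ℝ => x ^ v) A

/-- The Frobenius norm of a complex matrix. -/
noncomputable def frobNorm {n : ℕ} (M : Matrix (Fin n) (Fin n) ℂ) : ℝ :=
  Real.sqrt (∑ i, ∑ j, ‖M i j‖ ^ 2)

/-- The operator norm of a complex matrix induced by the Euclidean norm on `ℂⁿ`. -/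
noncomputable def l2OpNorm {n : ℕ} (M : Matrix (Fin n) (Fin n) ℂ) : ℝ :=
  ‖Matrix.toEuclideanCLM (𝕜 := ℂ) M‖

/-- Convexity of `sinh` on `[0, ∞)` together with `sinh 0 = 0`. -/
lemma Real.sinh_mul_le_mul_sinh {r x : ℝ} (hr0 : 0 ≤ r) (hr1 : r ≤ 1) (hx : 0 ≤ x) :
    Real.sinh (r * x) ≤ r * Real.sinh x := by
  have hconv : ConvexOn ℝ (Set.Ici 0) Real.sinh := by
    refine convexOn_of_deriv2_nonneg (convex_Ici 0) Real.continuous_sinh.continuousOn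
      Real.differentiable_sinh.differentiableOn ?_ ?_
    · rw [Real.deriv_sinh]
      exact Real.differentiable_cosh.differentiableOn
    · intro y hy
      rw [interior_Ici] at hy
      simpa using (Set.mem_Ioi.mp hy).le
  simpa using hconv.2 (Set.mem_Ici.mpr hx) (Set.mem_Ici.mpr le_rfl) hr0
    (sub_nonneg.mpr hr1) (by ring)

lemma Real.rpow_mul_rpow_sub_eq_sinh {a b : ℝ} (ha : 0 < a) (hb : 0 < b) (t : ℝ) :
    a ^ (1 - t) * b ^ t - a ^ t * b ^ (1 - t) =
      2 * Real.exp ((Real.log a + Real.log b) / 2) *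
        Real.sinh ((1 - 2 * t) * ((Real.log a - Real.log b) / 2)) := by
  simp only [Real.rpow_def_of_pos ha, Real.rpow_def_of_pos hb, ← Real.exp_add, Real.sinh_eq]
  rw [mul_assoc, ← mul_div_assoc, mul_div_cancel₀ _ (two_ne_zero' ℝ), mul_sub (Real.exp _),
    ← Real.exp_add, ← Real.exp_add]
  ring_nf

/-- The scalar comparison of Heinz differences. -/
lemma abs_heinz_diff_le {a b s t : ℝ} (ha : 0 ≤ a) (hb : 0 ≤ b) (ht0 : 0 < t) (ht1 : t < 1)
    (hts : |1 - 2 * t| < |1 - 2 * s|) :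
    |a ^ (1 - t) * b ^ t - a ^ t * b ^ (1 - t)| ≤
      |(1 - 2 * t) / (1 - 2 * s)| * |a ^ (1 - s) * b ^ s - a ^ s * b ^ (1 - s)| := by
  have hs : 0 < |1 - 2 * s| := (abs_nonneg _).trans_lt hts
  have ht0' : t ≠ 0 := ht0.ne'
  have ht1' : 1 - t ≠ 0 := (sub_pos.mpr ht1).ne'
  rcases ha.eq_or_lt with rfl | ha
  · simp only [Real.zero_rpow ht0', Real.zero_rpow ht1', zero_mul, sub_zero, abs_zero]
    positivity
  rcases hb.eq_or_lt with rfl | hb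
  · simp only [Real.zero_rpow ht0', Real.zero_rpow ht1', mul_zero, sub_zero, abs_zero]
    positivity
  rw [Real.rpow_mul_rpow_sub_eq_sinh ha hb, Real.rpow_mul_rpow_sub_eq_sinh ha hb]
  set d := (Real.log a - Real.log b) / 2
  set c := 2 * Real.exp ((Real.log a + Real.log b) / 2) with hc
  have hc0 : 0 ≤ c := by positivity
  have key := Real.sinh_mul_le_mul_sinh (x := |1 - 2 * s| * |d|)
    (div_nonneg (abs_nonneg (1 - 2 * t)) hs.le) ((div_le_one hs).mpr hts.le) (by positivity)
  rw [← mul_assoc, div_mul_cancel₀ _ hs.ne'] at key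
  simp only [abs_mul, Real.abs_sinh, abs_div, abs_of_nonneg hc0]
  calc c * Real.sinh (|1 - 2 * t| * |d|)
      ≤ c * (|1 - 2 * t| / |1 - 2 * s| * Real.sinh (|1 - 2 * s| * |d|)) := by gcongr
    _ = _ := by ring

lemma mpow_eq_conj_diagonal {n : ℕ} {A : Matrix (Fin n) (Fin n) ℂ} (hA : A.IsHermitian) (v : ℝ) :
    mpow A v = (hA.eigenvectorUnitary : Matrix (Fin n) (Fin n) ℂ) *
      Matrix.diagonal (fun i => ((hA.eigenvalues i ^ v : ℝ) : ℂ)) *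
      star (hA.eigenvectorUnitary : Matrix (Fin n) (Fin n) ℂ) := by
  rw [mpow, hA.cfc_eq, Matrix.IsHermitian.cfc, Unitary.conjStarAlgAut_apply]
  rfl

lemma frobNorm_eq_sqrt_trace {n : ℕ} (M : Matrix (Fin n) (Fin n) ℂ) :
    frobNorm M = Real.sqrt (star M * M).trace.re := by
  rw [frobNorm, Finset.sum_comm]
  congr 1
  simp [Matrix.trace, Matrix.mul_apply, Matrix.star_apply, ← Complex.normSq_eq_norm_sq,
    Complex.normSq_apply]

lemma frobNorm_unitary_mul_mul_star {n : ℕ} (U V : Matrix.unitaryGroup (Fin n) ℂ)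
    (M : Matrix (Fin n) (Fin n) ℂ) :
    frobNorm ((U : Matrix (Fin n) (Fin n) ℂ) * M * star (V : Matrix (Fin n) (Fin n) ℂ)) =
      frobNorm M := by
  have hU : star (U : Matrix (Fin n) (Fin n) ℂ) * U = 1 := Unitary.coe_star_mul_self U
  have hV : star (V : Matrix (Fin n) (Fin n) ℂ) * V = 1 := Unitary.coe_star_mul_self V
  rw [frobNorm_eq_sqrt_trace, frobNorm_eq_sqrt_trace, star_mul, star_mul, star_star]
  have h : (V : Matrix (Fin n) (Fin n) ℂ) * (star M * star (U : Matrix (Fin n) (Fin n) ℂ)) *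
      (U * M * star (V : Matrix (Fin n) (Fin n) ℂ)) = V * (star M * M) * star V.1 := by
    calc _ = V * (star M * (star (U : Matrix (Fin n) (Fin n) ℂ) * U) * M) * star V.1 := by
          simp only [mul_assoc]
      _ = _ := by rw [hU, mul_one]
  rw [h, Matrix.trace_mul_comm, ← mul_assoc, hV, one_mul]

lemma frobNorm_le_mul_of_norm_le {n : ℕ} {M N : Matrix (Fin n) (Fin n) ℂ} {r : ℝ} (hr : 0 ≤ r)
    (h : ∀ i j, ‖M i j‖ ≤ r * ‖N i j‖) : frobNorm M ≤ r * frobNorm N := by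
  rw [frobNorm, frobNorm, ← Real.sqrt_sq hr, ← Real.sqrt_mul (sq_nonneg r)]
  refine Real.sqrt_le_sqrt ?_
  simp only [Finset.mul_sum, ← mul_pow]
  gcongr with i _ j _
  exact h i j

/-- In eigenbases of `A` and `B`, the Heinz difference acts as a Schur multiplier. -/
lemma frobNorm_heinz_diff_eq {n : ℕ} {A B : Matrix (Fin n) (Fin n) ℂ} (hA : A.IsHermitian)
    (hB : B.IsHermitian) (X : Matrix (Fin n) (Fin n) ℂ) (t : ℝ) :
    frobNorm (mpow A (1 - t) * X * mpow B t - mpow A t * X * mpow B (1 - t)) =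
      frobNorm (Matrix.of fun i j =>
        ((hA.eigenvalues i ^ (1 - t) * hB.eigenvalues j ^ t -
          hA.eigenvalues i ^ t * hB.eigenvalues j ^ (1 - t) : ℝ) : ℂ) *
        (star (hA.eigenvectorUnitary : Matrix (Fin n) (Fin n) ℂ) * X *
          hB.eigenvectorUnitary) i j) := by
  rw [← frobNorm_unitary_mul_mul_star hA.eigenvectorUnitary hB.eigenvectorUnitary (Matrix.of _)]
  congr 1
  simp only [mpow_eq_conj_diagonal hA, mpow_eq_conj_diagonal hB]
  set U := (hA.eigenvectorUnitary : Matrix (Fin n) (Fin n) ℂ)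
  set V := (hB.eigenvectorUnitary : Matrix (Fin n) (Fin n) ℂ)
  have hconj : ∀ D E : Matrix (Fin n) (Fin n) ℂ,
      U * D * star U * X * (V * E * star V) = U * (D * (star U * X * V) * E) * star V := by
    intro D E
    simp only [mul_assoc]
  rw [hconj, hconj, ← sub_mul, ← mul_sub]
  congr 2
  ext i j
  rw [Matrix.sub_apply, Matrix.mul_diagonal, Matrix.mul_diagonal, Matrix.diagonal_mul,
    Matrix.diagonal_mul, Matrix.of_apply]
  push_cast
  ring

/-- Theorem 2.5 for the Frobenius norm. -/
theorem heinz_diff_frobenius (n : ℕ) (A B X : Matrix (Fin n) (Fin n) ℂ)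
    (hA : A.PosSemidef) (hB : B.PosSemidef) (s t : ℝ)
    (hs0 : 0 ≤ s) (hs1 : s ≤ 1) (ht0 : 0 ≤ t) (ht1 : t ≤ 1)
    (hts : |1 - 2 * t| < |1 - 2 * s|) (hsign : 0 < (1 - 2 * t) * (1 - 2 * s)) :
    frobNorm (mpow A (1 - t) * X * mpow B t - mpow A t * X * mpow B (1 - t)) ≤
      |(1 - 2 * t) / (1 - 2 * s)| *
        frobNorm (mpow A (1 - s) * X * mpow B s - mpow A s * X * mpow B (1 - s)) := by
  have ht : 0 < t ∧ t < 1 := by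
    have h1 : |1 - 2 * s| ≤ 1 := abs_le.mpr ⟨by linarith, by linarith⟩
    have h2 := abs_lt.mp (hts.trans_le h1)
    exact ⟨by linarith, by linarith⟩
  rw [frobNorm_heinz_diff_eq hA.isHermitian hB.isHermitian,
    frobNorm_heinz_diff_eq hA.isHermitian hB.isHermitian]
  refine frobNorm_le_mul_of_norm_le (abs_nonneg _) fun i j => ?_
  rw [Matrix.of_apply, Matrix.of_apply, norm_mul, norm_mul, Complex.norm_real, Complex.norm_real,
    Real.norm_eq_abs, Real.norm_eq_abs, ← mul_assoc]
  exact mul_le_mul_of_nonneg_right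
    (abs_heinz_diff_le (hA.eigenvalues_nonneg i) (hB.eigenvalues_nonneg j) ht.1 ht.2 hts)
    (norm_nonneg _)
end
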